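/- Under the Setup, R′ preserves Gorenstein injectivity: if m is a Gorenstein injective right R-module, then R′(m) is a Gorenstein injective right S-module. -/

import Mathlib

/-!
Statement 9: Under the Setup (R, S Gorenstein rings, adjoint triple L ⊣ G ⊣ R′ of additive
functors between the categories of right modules, with G fully faithful and L exact), R′
preserves Gorenstein injectivity: if m is a Gorenstein injective right R-module, then R′(m)
is a Gorenstein injective right S-module.
Right A-modules are formalized as objects of `ModuleCat Aᵐᵒᵖ`; Gorenstein injectivity is
expressed by the vanishing of Ext^i(E, −) for i ≥ 1 against all modules E of finite
injective dimension.
-/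

open CategoryTheory CategoryTheory.Abelian CategoryTheory.Limits

universe u

noncomputable instance moduleCatHasExt (A : Type u) [Ring A] :
    HasExt.{u + 1} (ModuleCat.{u} A) := by
  letI := HasDerivedCategory.standard (ModuleCat.{u} A)
  exact hasExt_of_hasDerivedCategory _

/-- `M` has finite projective dimension: there is `d` such that `Ext^i(M, N) = 0`
for every module `N` and every `i > d`. -/
def HasFinProjDim (A : Type u) [Ring A] (M : ModuleCat.{u} A) : Prop :=
  ∃ d : ℕ, ∀ (N : ModuleCat.{u} A) (i : ℕ), d < i → Subsingleton (Ext M N i)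

/-- `M` has finite injective dimension: there is `d` such that `Ext^i(N, M) = 0`
for every module `N` and every `i > d`. -/
def HasFinInjDim (A : Type u) [Ring A] (M : ModuleCat.{u} A) : Prop :=
  ∃ d : ℕ, ∀ (N : ModuleCat.{u} A) (i : ℕ), d < i → Subsingleton (Ext N M i)

/-- A ring is Gorenstein if it is left and right Noetherian and has finite injective
dimension as a right module and as a left module over itself. -/
def IsGorensteinRing (A : Type u) [Ring A] : Prop :=
  IsNoetherianRing A ∧ IsNoetherianRing Aᵐᵒᵖ ∧
    HasFinInjDim Aᵐᵒᵖ (ModuleCat.of Aᵐᵒᵖ A) ∧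
    HasFinInjDim A (ModuleCat.of A A)

/-- `M` is Gorenstein injective: `Ext^i(E, M) = 0` for all `i ≥ 1` and all modules `E`
of finite injective dimension. -/
def IsGorensteinInjective (A : Type u) [Ring A] (M : ModuleCat.{u} A) : Prop :=
  ∀ E : ModuleCat.{u} A, HasFinInjDim A E → ∀ i : ℕ, 1 ≤ i → Subsingleton (Ext E M i)

namespace CategoryTheory

variable {C D : Type*} [Category* C] [Category* D] [Abelian C] [Abelian D]

/-- The short complex given by an embedding of `X` into an injective object and its cokernel. -/
noncomputable def injectiveEmbedding [EnoughInjectives C] (X : C) : ShortComplex C :=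
  .mk (Injective.ι X) (cokernel.π (Injective.ι X)) (cokernel.condition _)

lemma injectiveEmbedding_shortExact [EnoughInjectives C] (X : C) :
    (injectiveEmbedding X).ShortExact where
  exact := ShortComplex.exact_cokernel _
  mono_f := inferInstanceAs (Mono (Injective.ι X))
  epi_g := inferInstanceAs (Epi (cokernel.π (Injective.ι X)))

instance [EnoughInjectives C] (X : C) : Injective (injectiveEmbedding X).X₂ :=
  inferInstanceAs (Injective (Injective.under X))

section Ext

universe w

variable [HasExt.{w} C]

lemma ShortComplex.ShortExact.exists_lift_of_subsingleton_ext_one {T : ShortComplex C}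
    (hT : T.ShortExact) {X : C} (hX : Subsingleton (Ext X T.X₁ 1)) (f : X ⟶ T.X₃) :
    ∃ g : X ⟶ T.X₂, g ≫ T.g = f := by
  obtain ⟨φ, hφ⟩ := Ext.covariant_sequence_exact₃ X hT (Ext.mk₀ f) (zero_add 1)
    (Subsingleton.elim _ _)
  obtain ⟨g, rfl⟩ := Ext.homEquiv₀.symm.surjective φ
  exact ⟨g, Ext.homEquiv₀.symm.injective (by simpa using hφ)⟩

lemma ShortComplex.ShortExact.subsingleton_ext_one {T : ShortComplex C}
    (hT : T.ShortExact) [Injective T.X₂] {X : C}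
    (hX : ∀ f : X ⟶ T.X₃, ∃ g : X ⟶ T.X₂, g ≫ T.g = f) :
    Subsingleton (Ext X T.X₁ 1) := by
  refine subsingleton_of_forall_eq 0 fun x => ?_
  obtain ⟨y, rfl⟩ := Ext.covariant_sequence_exact₁ X hT x (Ext.eq_zero_of_injective _) (zero_add 1)
  obtain ⟨f, rfl⟩ := Ext.homEquiv₀.symm.surjective y
  obtain ⟨g, rfl⟩ := hX f
  rw [Ext.homEquiv₀_symm_apply, ← Ext.mk₀_comp_mk₀, Ext.comp_assoc_of_second_deg_zero,
    hT.comp_extClass, Ext.comp_zero]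

lemma ShortComplex.ShortExact.subsingleton_ext_succ_iff {T : ShortComplex C}
    (hT : T.ShortExact) [Injective T.X₂] (X : C) (i : ℕ) :
    Subsingleton (Ext X T.X₁ (i + 2)) ↔ Subsingleton (Ext X T.X₃ (i + 1)) := by
  refine ⟨fun h => subsingleton_of_forall_eq 0 fun x => ?_,
    fun h => subsingleton_of_forall_eq 0 fun x => ?_⟩
  · obtain ⟨y, rfl⟩ := Ext.covariant_sequence_exact₃ X hT x rfl (Subsingleton.elim _ _)
    rw [y.eq_zero_of_injective, Ext.zero_comp]
  · obtain ⟨y, rfl⟩ := Ext.covariant_sequence_exact₁ X hT x (Ext.eq_zero_of_injective _) rfl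
    rw [Subsingleton.elim y 0, Ext.zero_comp]

end Ext

lemma Functor.hasInjectiveDimensionLT_obj (G : C ⥤ D) [G.Additive] [PreservesFiniteLimits G]
    [PreservesFiniteColimits G] [EnoughInjectives C]
    (hG : ∀ I : C, Injective I → Injective (G.obj I)) (X : C) (n : ℕ)
    [HasInjectiveDimensionLT X n] : HasInjectiveDimensionLT (G.obj X) n := by
  induction n generalizing X with
  | zero =>
    exact (G.map_isZero (isZero_of_hasInjectiveDimensionLT_zero X)).hasInjectiveDimensionLT_zero
  | succ n ih =>
    have hT := injectiveEmbedding_shortExact X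
    have : Injective (G.obj (injectiveEmbedding X).X₂) := hG _ inferInstance
    obtain _ | n := n
    · have := hG X (injective_iff_hasInjectiveDimensionLT_one.2 ‹_›)
      infer_instance
    · have : HasInjectiveDimensionLT (injectiveEmbedding X).X₃ (n + 1) :=
        (hT.hasInjectiveDimensionLT_X₃_iff n inferInstance).2 ‹_›
      have : Injective ((injectiveEmbedding X).map G).X₂ := ‹Injective (G.obj _)›
      exact ((hT.map_of_exact G).hasInjectiveDimensionLT_X₃_iff n this).1 (ih _)

universe w w'

/-- If `G` preserves monomorphisms and has a right adjoint `F`, `P` detects epimorphisms, and the higher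
`Ext` groups from `G.obj P` and `G.obj E` to `m` vanish, then the higher `Ext` groups from `E` to
`F.obj m` vanish. -/
lemma Adjunction.subsingleton_ext_obj [HasExt.{w} C] [HasExt.{w'} D] [EnoughInjectives D]
    {G : C ⥤ D} {F : D ⥤ C} (adj : G ⊣ F) [F.Additive] [G.PreservesMonomorphisms] {P E : C}
    (hP : ∀ ⦃A B : C⦄ (f : A ⟶ B), (∀ s : P ⟶ B, ∃ t : P ⟶ A, t ≫ f = s) → Epi f)
    (m : D) (hPm : ∀ i, Subsingleton (Ext (G.obj P) m (i + 1)))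
    (hEm : ∀ i, Subsingleton (Ext (G.obj E) m (i + 1))) (i : ℕ) :
    Subsingleton (Ext E (F.obj m) (i + 1)) := by
  have := adj.rightAdjoint_preservesLimits
  have hT := injectiveEmbedding_shortExact m
  have lift (X : C) (hX : Subsingleton (Ext (G.obj X) m 1))
      (s : X ⟶ F.obj (injectiveEmbedding m).X₃) :
      ∃ t : X ⟶ F.obj (injectiveEmbedding m).X₂, t ≫ F.map (injectiveEmbedding m).g = s := by
    obtain ⟨g, hg⟩ := hT.exists_lift_of_subsingleton_ext_one hX ((adj.homEquiv _ _).symm s)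
    exact ⟨adj.homEquiv _ _ g, by rw [← adj.homEquiv_naturality_right, hg, Equiv.apply_symm_apply]⟩
  have hFT : ((injectiveEmbedding m).map F).ShortExact :=
    have := hT.mono_f
    { exact := hT.exact.map_of_mono_of_preservesKernel F inferInstance inferInstance
      mono_f := inferInstanceAs (Mono (F.map _))
      epi_g := hP _ (lift P (hPm 0)) }
  have : Injective ((injectiveEmbedding m).map F).X₂ :=
    Injective.injective_of_adjoint adj (injectiveEmbedding m).X₂
  match i with
  | 0 => exact hFT.subsingleton_ext_one (lift E (hEm 0))
  | i + 1 => exact (hFT.subsingleton_ext_succ_iff E i).2 (adj.subsingleton_ext_obj hP _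
      (fun j => (hT.subsingleton_ext_succ_iff _ j).1 (hPm (j + 1)))
      (fun j => (hT.subsingleton_ext_succ_iff _ j).1 (hEm (j + 1))) i)

end CategoryTheory

lemma ModuleCat.epi_of_forall_exists_lift {A : Type u} [Ring A] ⦃M N : ModuleCat.{u} Aᵐᵒᵖ⦄
    (f : M ⟶ N)
    (hf : ∀ s : ModuleCat.of Aᵐᵒᵖ A ⟶ N, ∃ t : ModuleCat.of Aᵐᵒᵖ A ⟶ M, t ≫ f = s) : Epi f := by
  rw [ModuleCat.epi_iff_surjective]
  intro b
  let s : A →ₗ[Aᵐᵒᵖ] N :=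
    { toFun a := MulOpposite.op a • b
      map_add' := by simp [add_smul]
      map_smul' := by simp [mul_smul] }
  obtain ⟨t, ht⟩ := hf (ModuleCat.ofHom s)
  exact ⟨t (1 : A), by simpa [s] using ConcreteCategory.congr_hom ht (1 : A)⟩

lemma hasFinInjDim_iff (A : Type u) [Ring A] (M : ModuleCat.{u} A) :
    HasFinInjDim A M ↔ ∃ n, HasInjectiveDimensionLT M n :=
  ⟨fun ⟨d, hd⟩ => ⟨d + 1, (hasInjectiveDimensionLT_iff _ _).2 fun i hi N _ =>
    have := hd N i hi
    Subsingleton.elim _ _⟩,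
  fun ⟨n, _⟩ => ⟨n, fun N i hi => HasInjectiveDimensionLT.subsingleton M n i hi.le N⟩⟩

theorem right_adjoint_preserves_gorensteinInjective
    {R S : Type u} [Ring R] [Ring S]
    (hR : IsGorensteinRing R) (hS : IsGorensteinRing S)
    (L : ModuleCat.{u} Rᵐᵒᵖ ⥤ ModuleCat.{u} Sᵐᵒᵖ)
    (G : ModuleCat.{u} Sᵐᵒᵖ ⥤ ModuleCat.{u} Rᵐᵒᵖ)
    (R' : ModuleCat.{u} Rᵐᵒᵖ ⥤ ModuleCat.{u} Sᵐᵒᵖ)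
    [L.Additive] [G.Additive] [R'.Additive]
    (adj₁ : L ⊣ G) (adj₂ : G ⊣ R')
    [G.Full] [G.Faithful]
    [PreservesFiniteLimits L] [PreservesFiniteColimits L]
    (m : ModuleCat.{u} Rᵐᵒᵖ) (hm : IsGorensteinInjective Rᵐᵒᵖ m) :
    IsGorensteinInjective Sᵐᵒᵖ (R'.obj m) := by
  have := adj₁.isRightAdjoint
  have := adj₂.isLeftAdjoint
  have hG (E : ModuleCat.{u} Sᵐᵒᵖ) (hE : HasFinInjDim Sᵐᵒᵖ E) :
      HasFinInjDim Rᵐᵒᵖ (G.obj E) := by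
    rw [hasFinInjDim_iff] at hE ⊢
    obtain ⟨n, _⟩ := hE
    exact ⟨n, G.hasInjectiveDimensionLT_obj (fun I _ => Injective.injective_of_adjoint adj₁ I) E n⟩
  rintro E hE (_ | i) hi
  · simp at hi
  · exact adj₂.subsingleton_ext_obj ModuleCat.epi_of_forall_exists_lift m
      (fun i => hm _ (hG _ hS.2.2.1) _ i.succ_pos) (fun i => hm _ (hG _ hE) _ i.succ_pos) i
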